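/- (Harmonic decomposition of elasticity-type tensors.) Let E be a real-valued quadrilinear form on ℝ³ with the minor and major symmetries E(x,y,z,w) = E(y,x,z,w) = E(x,y,w,z) = E(z,w,x,y). Define the dilatation tensor di_{kl} = Σ_i E(e_i,e_i,e_k,e_l) and the Voigt tensor vo_{jl} = Σ_i E(e_i,e_j,e_i,e_l). Then E decomposes uniquely as E = α Id ⊗₍₄₎ Id + β Id ⊗₍₂,₂₎ Id + Id ⊗₍₄₎ a′ + Id ⊗₍₂,₂₎ b′ + H, where H is a harmonic (totally symmetric, traceless) fourth-order tensor, and necessarily α = (1/15)(tr di + 2 tr vo), β = (1/6)(tr di − tr vo), a′ = (2/7)(di′ + 2 vo′), b′ = 2(di′ − vo′), with A′ = A − (1/3)(tr A) Id denoting deviatoric parts. -/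

import Mathlib

open Matrix

/-- The tensor product `(y ⊗ z)_{ijkl} = y_{ij} z_{kl}` of two 3×3 matrices. -/
def tens (y z : Matrix (Fin 3) (Fin 3) ℝ) : Fin 3 → Fin 3 → Fin 3 → Fin 3 → ℝ :=
  fun i j k l => y i j * z k l

/-- The product `(y ⊗̄ z)_{ijkl} = (1/2)(y_{ik} z_{jl} + y_{il} z_{jk})`. -/
noncomputable def obar (y z : Matrix (Fin 3) (Fin 3) ℝ) : Fin 3 → Fin 3 → Fin 3 → Fin 3 → ℝ :=
  fun i j k l => 1 / 2 * (y i k * z j l + y i l * z j k)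

/-- The Young-symmetrized product `y ⊗₍₄₎ z`. -/
noncomputable def prod4 (y z : Matrix (Fin 3) (Fin 3) ℝ) : Fin 3 → Fin 3 → Fin 3 → Fin 3 → ℝ :=
  fun i j k l => 1 / 6 * (tens y z i j k l + tens z y i j k l
    + 2 * obar y z i j k l + 2 * obar z y i j k l)

/-- The Young-symmetrized product `y ⊗₍₂,₂₎ z`. -/
noncomputable def prod22 (y z : Matrix (Fin 3) (Fin 3) ℝ) : Fin 3 → Fin 3 → Fin 3 → Fin 3 → ℝ :=
  fun i j k l => 1 / 3 * (tens y z i j k l + tens z y i j k l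
    - obar y z i j k l - obar z y i j k l)

/-- A fourth-order tensor is totally symmetric if it is invariant under all permutations of
its four indices. -/
def TotallySymmetric4 (H : Fin 3 → Fin 3 → Fin 3 → Fin 3 → ℝ) : Prop :=
  ∀ (v : Fin 4 → Fin 3) (π : Equiv.Perm (Fin 4)),
    H (v (π 0)) (v (π 1)) (v (π 2)) (v (π 3)) = H (v 0) (v 1) (v 2) (v 3)

/-- A fourth-order tensor is traceless if `Σ_i H_{iikl} = 0` for all `k, l`. -/
def Traceless4 (H : Fin 3 → Fin 3 → Fin 3 → Fin 3 → ℝ) : Prop :=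
  ∀ k l, ∑ i, H i i k l = 0

/-- Invariance under the adjacent transpositions suffices for total symmetry. -/
theorem totallySymmetric4_of_swaps {H : Fin 3 → Fin 3 → Fin 3 → Fin 3 → ℝ}
    (h01 : ∀ i j k l, H j i k l = H i j k l) (h12 : ∀ i j k l, H i k j l = H i j k l)
    (h23 : ∀ i j k l, H i j l k = H i j k l) : TotallySymmetric4 H := by
  intro v π
  have hπ : π ∈ Submonoid.closure
      (Set.range fun i : Fin 3 => Equiv.swap i.castSucc i.succ) := by
    rw [Equiv.Perm.mclosure_swap_castSucc_succ]
    trivial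
  induction hπ using Submonoid.closure_induction generalizing v with
  | mem σ hσ =>
    obtain ⟨i, rfl⟩ := hσ
    fin_cases i
    · exact h01 _ _ _ _
    · exact h12 _ _ _ _
    · exact h23 _ _ _ _
  | one => rfl
  | mul σ τ _ _ hσ hτ => exact (hτ (v ∘ σ)).trans (hσ v)

theorem TotallySymmetric4.swap_middle {H : Fin 3 → Fin 3 → Fin 3 → Fin 3 → ℝ}
    (hH : TotallySymmetric4 H) (i j k l : Fin 3) : H i k j l = H i j k l :=
  hH ![i, j, k, l] (Equiv.swap 1 2)

theorem sum_prod4_one_dilatation {a : Matrix (Fin 3) (Fin 3) ℝ} (ha : a.IsSymm) (k l : Fin 3) :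
    ∑ i, prod4 1 a i i k l =
      (7 * a k l + a.trace * (1 : Matrix (Fin 3) (Fin 3) ℝ) k l) / 6 := by
  have h := ha.apply
  fin_cases k <;> fin_cases l <;>
    simp [prod4, tens, obar, Fin.sum_univ_three, Matrix.trace, Matrix.one_apply,
      h 0 1, h 0 2, h 1 2] <;> ring

theorem prod4_one_swap_middle {a : Matrix (Fin 3) (Fin 3) ℝ} (ha : a.IsSymm) (i j k l : Fin 3) :
    prod4 1 a i k j l = prod4 1 a i j k l := by
  simp only [prod4, tens, obar, ha.apply j k, (Matrix.isSymm_one (n := Fin 3) (α := ℝ)).apply j k]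
  ring

theorem sum_prod22_one_dilatation {b : Matrix (Fin 3) (Fin 3) ℝ} (hb : b.IsSymm) (k l : Fin 3) :
    ∑ i, prod22 1 b i i k l =
      (b k l + b.trace * (1 : Matrix (Fin 3) (Fin 3) ℝ) k l) / 3 := by
  have h := hb.apply
  fin_cases k <;> fin_cases l <;>
    simp [prod22, tens, obar, Fin.sum_univ_three, Matrix.trace, Matrix.one_apply,
      h 0 1, h 0 2, h 1 2] <;> ring

theorem sum_prod22_one_voigt {b : Matrix (Fin 3) (Fin 3) ℝ} (hb : b.IsSymm) (j l : Fin 3) :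
    ∑ i, prod22 1 b i j i l =
      -(b j l + b.trace * (1 : Matrix (Fin 3) (Fin 3) ℝ) j l) / 6 := by
  have h := hb.apply
  fin_cases j <;> fin_cases l <;>
    simp [prod22, tens, obar, Fin.sum_univ_three, Matrix.trace, Matrix.one_apply,
      h 0 1, h 0 2, h 1 2] <;> ring

set_option maxHeartbeats 1000000 in
/-- In dimension three, the part of `E` that is not totally symmetric is determined by the
difference of the dilatation and Voigt tensors, like a curvature tensor by its Ricci tensor. -/
theorem sub_swap_middle_eq_prod22 {E : Fin 3 → Fin 3 → Fin 3 → Fin 3 → ℝ}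
    (hminor1 : ∀ i j k l, E i j k l = E j i k l) (hminor2 : ∀ i j k l, E i j k l = E i j l k)
    (hmajor : ∀ i j k l, E i j k l = E k l i j) {di vo : Matrix (Fin 3) (Fin 3) ℝ}
    (hdi : ∀ k l, di k l = ∑ i, E i i k l) (hvo : ∀ j l, vo j l = ∑ i, E i j i l)
    (i j k l : Fin 3) :
    E i j k l - E i k j l =
      1 / 6 * (di.trace - vo.trace) * (prod22 1 1 i j k l - prod22 1 1 i k j l)
        + (prod22 1 ((2 : ℝ) • ((di - (di.trace / 3) • 1) - (vo - (vo.trace / 3) • 1))) i j k l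
          - prod22 1 ((2 : ℝ) • ((di - (di.trace / 3) • 1) - (vo - (vo.trace / 3) • 1))) i k j l)
      := by
  have m1 := hminor1 1 0
  have m2 := hminor1 2 0
  have m3 := hminor1 2 1
  have n1 := fun i j => hminor2 i j 1 0
  have n2 := fun i j => hminor2 i j 2 0
  have n3 := fun i j => hminor2 i j 2 1
  fin_cases i <;> fin_cases j <;> fin_cases k <;> fin_cases l <;>
    simp [prod22, tens, obar, Fin.sum_univ_three, Matrix.trace, hdi, hvo,
      m1, m2, m3, n1, n2, n3, hmajor 0 1 0 0, hmajor 0 2 0 0, hmajor 0 2 0 1, hmajor 1 1 0 0,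
      hmajor 1 1 0 1, hmajor 1 1 0 2, hmajor 1 2 0 0, hmajor 1 2 0 1, hmajor 1 2 0 2,
      hmajor 1 2 1 1, hmajor 2 2 0 0, hmajor 2 2 0 1, hmajor 2 2 0 2, hmajor 2 2 1 1,
      hmajor 2 2 1 2] <;> ring

/-- **Backus's harmonic decomposition of elasticity tensors.** A quadrilinear form `E` on ℝ³
with minor and major symmetries decomposes uniquely as
`E = α Id⊗₍₄₎Id + β Id⊗₍₂,₂₎Id + Id⊗₍₄₎a′ + Id⊗₍₂,₂₎b′ + H` with `H` harmonic (totally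
symmetric traceless) and `a′, b′` symmetric deviators; necessarily
`α = (1/15)(tr di + 2tr vo)`, `β = (1/6)(tr di − tr vo)`, `a′ = (2/7)(di′ + 2vo′)`,
`b′ = 2(di′ − vo′)`, where `di` and `vo` are the dilatation and Voigt tensors of `E`. -/
theorem harmonic_decomposition_elasticity
    (E : Fin 3 → Fin 3 → Fin 3 → Fin 3 → ℝ)
    (hminor1 : ∀ i j k l, E i j k l = E j i k l)
    (hminor2 : ∀ i j k l, E i j k l = E i j l k)
    (hmajor : ∀ i j k l, E i j k l = E k l i j)
    (di vo di' vo' : Matrix (Fin 3) (Fin 3) ℝ)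
    (hdi : ∀ k l, di k l = ∑ i, E i i k l)
    (hvo : ∀ j l, vo j l = ∑ i, E i j i l)
    (hdi' : di' = di - (di.trace / 3) • (1 : Matrix (Fin 3) (Fin 3) ℝ))
    (hvo' : vo' = vo - (vo.trace / 3) • (1 : Matrix (Fin 3) (Fin 3) ℝ)) :
    (∃ H : Fin 3 → Fin 3 → Fin 3 → Fin 3 → ℝ,
      TotallySymmetric4 H ∧ Traceless4 H ∧
      ∀ i j k l, E i j k l =
        1 / 15 * (di.trace + 2 * vo.trace) * prod4 1 1 i j k l
          + 1 / 6 * (di.trace - vo.trace) * prod22 1 1 i j k l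
          + prod4 1 ((2 / 7 : ℝ) • (di' + (2 : ℝ) • vo')) i j k l
          + prod22 1 ((2 : ℝ) • (di' - vo')) i j k l
          + H i j k l)
    ∧ ∀ (α β : ℝ) (a' b' : Matrix (Fin 3) (Fin 3) ℝ)
        (H : Fin 3 → Fin 3 → Fin 3 → Fin 3 → ℝ),
        a'.IsSymm → a'.trace = 0 → b'.IsSymm → b'.trace = 0 →
        TotallySymmetric4 H → Traceless4 H →
        (∀ i j k l, E i j k l =
          α * prod4 1 1 i j k l + β * prod22 1 1 i j k l
            + prod4 1 a' i j k l + prod22 1 b' i j k l + H i j k l) →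
        α = 1 / 15 * (di.trace + 2 * vo.trace) ∧
        β = 1 / 6 * (di.trace - vo.trace) ∧
        a' = (2 / 7 : ℝ) • (di' + (2 : ℝ) • vo') ∧
        b' = (2 : ℝ) • (di' - vo') := by
  have sdi : di.IsSymm := Matrix.IsSymm.ext fun i j => by simp only [hdi, hminor2 _ _ i j]
  have svo : vo.IsSymm := Matrix.IsSymm.ext fun i j => by
    simp only [hvo]
    exact Finset.sum_congr rfl fun m _ => hmajor m j m i
  have s1 : (1 : Matrix (Fin 3) (Fin 3) ℝ).IsSymm := Matrix.isSymm_one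
  have t1 : (1 : Matrix (Fin 3) (Fin 3) ℝ).trace = 3 := by simp
  have sdi' : di'.IsSymm := hdi' ▸ sdi.sub (s1.smul _)
  have svo' : vo'.IsSymm := hvo' ▸ svo.sub (s1.smul _)
  have tdi' : di'.trace = 0 := by simp [hdi']
  have tvo' : vo'.trace = 0 := by simp [hvo']
  have sa : ((2 / 7 : ℝ) • (di' + (2 : ℝ) • vo')).IsSymm := (sdi'.add (svo'.smul _)).smul _
  have sb : ((2 : ℝ) • (di' - vo')).IsSymm := (sdi'.sub svo').smul _
  refine ⟨⟨fun i j k l => E i j k l - (1 / 15 * (di.trace + 2 * vo.trace) * prod4 1 1 i j k l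
      + 1 / 6 * (di.trace - vo.trace) * prod22 1 1 i j k l
      + prod4 1 ((2 / 7 : ℝ) • (di' + (2 : ℝ) • vo')) i j k l
      + prod22 1 ((2 : ℝ) • (di' - vo')) i j k l), totallySymmetric4_of_swaps ?_ ?_ ?_, ?_,
      fun i j k l => by ring⟩, ?_⟩
  · intro i j k l
    simp only [hminor1 j i, prod4, prod22, tens, obar, s1.apply i j, sa.apply i j, sb.apply i j]
    ring
  · intro i j k l
    have h := sub_swap_middle_eq_prod22 hminor1 hminor2 hmajor hdi hvo i j k l
    rw [← hdi', ← hvo'] at h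
    simp only [prod4_one_swap_middle s1 i j k l, prod4_one_swap_middle sa i j k l]
    linear_combination -h
  · intro i j k l
    simp only [hminor2 i j l k, prod4, prod22, tens, obar, s1.apply k l, sa.apply k l, sb.apply k l]
    ring
  · intro k l
    simp only [Finset.sum_sub_distrib, Finset.sum_add_distrib, ← Finset.mul_sum,
      sum_prod4_one_dilatation s1, sum_prod4_one_dilatation sa, sum_prod22_one_dilatation s1,
      sum_prod22_one_dilatation sb, ← hdi, t1, Matrix.trace_smul, Matrix.trace_add,
      Matrix.trace_sub, tdi', tvo', Matrix.smul_apply, Matrix.add_apply, Matrix.sub_apply,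
      smul_eq_mul]
    simp only [hdi', hvo', Matrix.sub_apply, Matrix.smul_apply, smul_eq_mul]
    ring
  · intro α β a' b' H ha ta hb tb hH tH hE
    have edi : di = (5 / 3 * α + 4 / 3 * β) • (1 : Matrix (Fin 3) (Fin 3) ℝ)
        + (7 / 6 : ℝ) • a' + (1 / 3 : ℝ) • b' := by
      ext k l
      simp only [hdi, hE, Finset.sum_add_distrib, ← Finset.mul_sum,
        sum_prod4_one_dilatation s1, sum_prod4_one_dilatation ha, sum_prod22_one_dilatation s1,
        sum_prod22_one_dilatation hb, t1, ta, tb, tH k l, Matrix.smul_apply, Matrix.add_apply,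
        smul_eq_mul]
      ring
    have evo : vo = (5 / 3 * α - 2 / 3 * β) • (1 : Matrix (Fin 3) (Fin 3) ℝ)
        + (7 / 6 : ℝ) • a' - (1 / 6 : ℝ) • b' := by
      ext j l
      have p1 : ∀ i, prod4 1 1 i j i l = prod4 1 1 i i j l :=
        fun i => prod4_one_swap_middle s1 i i j l
      have pa : ∀ i, prod4 1 a' i j i l = prod4 1 a' i i j l :=
        fun i => prod4_one_swap_middle ha i i j l
      have pH : ∀ i, H i j i l = H i i j l := fun i => hH.swap_middle i i j l
      simp only [hvo, hE, p1, pa, pH, Finset.sum_add_distrib, ← Finset.mul_sum,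
        sum_prod4_one_dilatation s1, sum_prod4_one_dilatation ha, sum_prod22_one_voigt s1,
        sum_prod22_one_voigt hb, t1, ta, tb, tH j l, Matrix.smul_apply, Matrix.add_apply,
        Matrix.sub_apply, smul_eq_mul]
      ring
    have tdi : di.trace = 5 * α + 4 * β := by
      rw [edi]
      simp only [Matrix.trace_add, Matrix.trace_smul, t1, ta, tb, smul_eq_mul]
      ring
    have tvo : vo.trace = 5 * α - 2 * β := by
      rw [evo]
      simp only [Matrix.trace_add, Matrix.trace_sub, Matrix.trace_smul, t1, ta, tb, smul_eq_mul]
      ring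
    refine ⟨by rw [tdi, tvo]; ring, by rw [tdi, tvo]; ring, ?_, ?_⟩
    · rw [hdi', hvo', tdi, tvo, edi, evo]
      module
    · rw [hdi', hvo', tdi, tvo, edi, evo]
      module
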